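/- Let N be a finite node set, R ⊆ N the set of source nodes, E a finite edge set where each edge e = {i,j} has incidence vector a_e = e_i − e_j ∈ ℝ^N, and B the N × R matrix with columns e_s, s ∈ R. For a weight vector w ∈ ℝ^E define A(w) = −Σ_{e∈E} w_e a_e a_eᵀ − B Bᵀ. Let h > 0 and let D ⊆ ℝ^E be a convex set of weight vectors on which −A(w) is positive definite. Then the function f(w) = −½·trace(Bᵀ A(w)⁻¹ B) + (h/2)·‖w‖² is strongly convex on D with parameter h; in particular, f(w) − (h/2)·‖w‖² is convex on D. -/

import Mathlib

open Matrix BigOperators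

/-- Matrix convexity of inversion on positive definite matrices, compressed by `C`. -/
theorem posSemidef_convexCombo_inv_sub {m n : Type*} [Fintype m] [DecidableEq m] [Fintype n]
    {P Q : Matrix m m ℝ} (hP : P.PosDef) (hQ : Q.PosDef) (C : Matrix m n ℝ) {s t : ℝ}
    (hs : 0 ≤ s) (ht : 0 ≤ t) (hst : s + t = 1) :
    (s • (Cᴴ * P⁻¹ * C) + t • (Cᴴ * Q⁻¹ * C) - Cᴴ * (s • P + t • Q)⁻¹ * C).PosSemidef := by
  have block : ∀ {M : Matrix m m ℝ}, M.PosDef →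
      (fromBlocks M C Cᴴ (Cᴴ * M⁻¹ * C)).PosSemidef := by
    intro M hM
    have := hM.isUnit.invertible
    rw [PosDef.fromBlocks₁₁ C _ hM, sub_self]
    exact PosSemidef.zero
  have hPQ : (s • P + t • Q).PosDef := by
    rcases hs.eq_or_lt with rfl | hs'
    · obtain rfl : t = 1 := by linarith
      simpa using hQ
    · exact (hP.smul hs').add_posSemidef (hQ.posSemidef.smul ht)
  have := hPQ.isUnit.invertible
  rw [← PosDef.fromBlocks₁₁ C _ hPQ]
  have key := ((block hP).smul hs).add ((block hQ).smul ht)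
  rwa [fromBlocks_smul, fromBlocks_smul, fromBlocks_add, ← add_smul, ← add_smul, hst, one_smul,
    one_smul] at key

/-- Convexity of `P ↦ trace (Cᵀ P⁻¹ C)` on positive definite matrices. -/
theorem trace_compress_inv_convexCombo_le {m n : Type*} [Fintype m] [DecidableEq m] [Fintype n]
    (C : Matrix m n ℝ) {P Q : Matrix m m ℝ} (hP : P.PosDef) (hQ : Q.PosDef) {s t : ℝ}
    (hs : 0 ≤ s) (ht : 0 ≤ t) (hst : s + t = 1) :
    trace (Cᵀ * (s • P + t • Q)⁻¹ * C) ≤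
      s * trace (Cᵀ * P⁻¹ * C) + t * trace (Cᵀ * Q⁻¹ * C) := by
  have key := (posSemidef_convexCombo_inv_sub hP hQ C hs ht hst).trace_nonneg
  simp only [conjTranspose_eq_transpose_of_trivial, trace_sub, trace_add, trace_smul,
    smul_eq_mul] at key
  linarith

/-- With `A(w) = −Σ_{e∈E} w_e a_e a_eᵀ − B Bᵀ` the grounded Laplacian,
`h > 0` and `D` a convex set of weight vectors on which `−A(w)` is positive definite,
the function `f(w) = −½·trace(Bᵀ A(w)⁻¹ B) + (h/2)·‖w‖²` is strongly convex on `D` with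
parameter `h`; in particular, `f(w) − (h/2)·‖w‖²` is convex on `D`. -/
theorem stmt_3 {N E : Type*} [Fintype N] [DecidableEq N] [Fintype E] [DecidableEq E]
    (R : Finset N) (ends : E → N × N)
    (a : E → N → ℝ)
    (ha : ∀ e, a e = Pi.single (ends e).1 1 - Pi.single (ends e).2 1)
    (B : Matrix N {s // s ∈ R} ℝ)
    (hB : ∀ (i : N) (s : {s // s ∈ R}), B i s = if i = (s : N) then 1 else 0)
    (A : EuclideanSpace ℝ E → Matrix N N ℝ)
    (hA : ∀ w, A w = -(∑ e, w e • Matrix.vecMulVec (a e) (a e)) - B * Bᵀ)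
    (h : ℝ) (hh : 0 < h)
    (D : Set (EuclideanSpace ℝ E)) (hD : Convex ℝ D)
    (hPD : ∀ w ∈ D, (-(A w)).PosDef)
    (f : EuclideanSpace ℝ E → ℝ)
    (hf : ∀ w, f w = -(1 / 2 : ℝ) * Matrix.trace (Bᵀ * (A w)⁻¹ * B) + h / 2 * ‖w‖ ^ 2) :
    StrongConvexOn D h f ∧ ConvexOn ℝ D (fun w => f w - h / 2 * ‖w‖ ^ 2) := by
  rw [strongConvexOn_iff_convex, and_self]
  refine ⟨hD, fun x hx y hy s t hs ht hst => ?_⟩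
  have affine : -(A (s • x + t • y)) = s • -(A x) + t • -(A y) := by
    have hBB : B * Bᵀ = s • (B * Bᵀ) + t • (B * Bᵀ) := by rw [← add_smul, hst, one_smul]
    have hsum : ∑ e, (s • x + t • y) e • vecMulVec (a e) (a e) =
        s • ∑ e, x e • vecMulVec (a e) (a e) + t • ∑ e, y e • vecMulVec (a e) (a e) := by
      simp [Finset.smul_sum, add_smul, mul_smul, Finset.sum_add_distrib]
    rw [hA, hA, hA, hsum]
    nth_rewrite 1 [hBB]
    module
  have inv_trace : ∀ w ∈ D, trace (Bᵀ * (-(A w))⁻¹ * B) = -trace (Bᵀ * (A w)⁻¹ * B) := by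
    intro w hw
    have hinv : (-(A w))⁻¹ = -(A w)⁻¹ := by
      have hdet : IsUnit (A w).det :=
        (isUnit_iff_isUnit_det _).mp (IsUnit.neg_iff (A w) |>.mp (hPD w hw).isUnit)
      exact inv_eq_right_inv (by rw [neg_mul_neg, mul_nonsing_inv _ hdet])
    rw [hinv, Matrix.mul_neg, Matrix.neg_mul, trace_neg]
  have key := trace_compress_inv_convexCombo_le B (hPD x hx) (hPD y hy) hs ht hst
  rw [← affine, inv_trace _ (hD hx hy hs ht hst), inv_trace x hx, inv_trace y hy] at key
  simp only [hf, smul_eq_mul]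
  linarith
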